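/- For every real x > 0, the power series √π · Σ_{n=0}^∞ xⁿ/Γ(n + 1/2) converges and equals 1 + 2·√x·e^x·∫₀^{√x} e^{−t²} dt. -/

import Mathlib

set_option autoImplicit false

lemma J_rec (y : ℝ) (n : ℕ) :
    (2 * n + 1 : ℝ) * (∫ t in (0:ℝ)..y, t ^ (2 * n) * Real.exp (-t ^ 2)) =
      y ^ (2 * n + 1) * Real.exp (-y ^ 2)
        + 2 * ∫ t in (0:ℝ)..y, t ^ (2 * (n + 1)) * Real.exp (-t ^ 2) := by
  have h := intervalIntegral.integral_eq_sub_of_hasDerivAt (a := 0) (b := y)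
    (f := fun t : ℝ => t ^ (2 * n + 1) * Real.exp (-t ^ 2))
    (f' := fun t : ℝ => (2 * n + 1 : ℝ) * (t ^ (2 * n) * Real.exp (-t ^ 2))
      - 2 * (t ^ (2 * (n + 1)) * Real.exp (-t ^ 2)))
    (by
      intro t _
      have h1 := (hasDerivAt_pow (2 * n + 1) t).mul ((hasDerivAt_pow 2 t).neg.exp)
      refine h1.congr_deriv ?_
      simp
      ring)
    (Continuous.intervalIntegrable (by fun_prop) _ _)
  rw [intervalIntegral.integral_sub (Continuous.intervalIntegrable (by fun_prop) _ _)
    (Continuous.intervalIntegrable (by fun_prop) _ _),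
    intervalIntegral.integral_const_mul, intervalIntegral.integral_const_mul] at h
  simp at h
  linarith

/-- the closed form of the kernel `K`:
`√π · Σ xⁿ/Γ(n+1/2) = 1 + 2√x eˣ ∫₀^√x e^{-t²} dt` for `x > 0`. -/
theorem stmt_10 (x : ℝ) (hx : 0 < x) :
    HasSum (fun n : ℕ => Real.sqrt Real.pi * x ^ n / Real.Gamma (n + 1/2))
      (1 + 2 * Real.sqrt x * Real.exp x * ∫ t in (0:ℝ)..Real.sqrt x, Real.exp (-t ^ 2)) := by
  set a : ℕ → ℝ := fun n : ℕ => Real.sqrt Real.pi * x ^ n / Real.Gamma (n + 1/2) with ha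
  set y := Real.sqrt x with hy
  have hy0 : 0 ≤ y := Real.sqrt_nonneg x
  have hyx : y ^ 2 = x := Real.sq_sqrt hx.le
  set S := 1 + 2 * y * Real.exp x * ∫ t in (0:ℝ)..y, Real.exp (-t ^ 2) with hS
  set J : ℕ → ℝ := fun n => ∫ t in (0:ℝ)..y, t ^ (2 * n) * Real.exp (-t ^ 2) with hJ
  set R : ℕ → ℝ := fun n => √Real.pi / Real.Gamma (n + 1/2) * (2 * y * Real.exp x * J n) with hR
  have hG : ∀ n : ℕ, 0 < Real.Gamma (n + 1/2) := fun n => Real.Gamma_pos_of_pos (by positivity)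
  have hGs : ∀ n : ℕ, Real.Gamma ((n + 1 : ℕ) + 1/2) = (n + 1/2) * Real.Gamma (n + 1/2) := by
    intro n
    rw [← Real.Gamma_add_one (by positivity)]
    congr 1
    push_cast
    ring
  have ha0 : ∀ n, 0 ≤ a n := fun n => by
    have := hG n
    simp only [ha]; positivity
  have hJ0 : ∀ n, 0 ≤ J n := fun n =>
    intervalIntegral.integral_nonneg hy0 (fun t ht => by
      have := ht.1
      positivity)
  have hR0 : ∀ n, 0 ≤ R n := fun n => by
    have := hG n
    have := hJ0 n
    simp only [hR]; positivity
  have hJle : ∀ n, J n ≤ y * x ^ n := by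
    intro n
    have h1 : J n ≤ ∫ t in (0:ℝ)..y, x ^ n := by
      apply intervalIntegral.integral_mono_on hy0
        (Continuous.intervalIntegrable (by fun_prop) _ _)
        (Continuous.intervalIntegrable (by fun_prop) _ _)
      intro t ht
      have h2 : t ^ (2 * n) ≤ x ^ n := by
        rw [← hyx, ← pow_mul]
        exact pow_le_pow_left₀ ht.1 ht.2 _
      have h3 : Real.exp (-t ^ 2) ≤ 1 := Real.exp_le_one_iff.2 (by nlinarith [sq_nonneg t])
      calc t ^ (2 * n) * Real.exp (-t ^ 2) ≤ x ^ n * 1 := by gcongr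
        _ = x ^ n := mul_one _
    simpa using h1
  have hRle : ∀ n, R n ≤ 2 * x * Real.exp x * a n := by
    intro n
    have hg := hG n
    calc R n ≤ √Real.pi / Real.Gamma (n + 1/2) * (2 * y * Real.exp x * (y * x ^ n)) := by
          simp only [hR]
          gcongr
          exact hJle n
      _ = 2 * y ^ 2 * Real.exp x * a n := by simp only [ha]; ring
      _ = _ := by rw [hyx]
  have key : ∀ N : ℕ, S = ∑ n ∈ Finset.range (N + 1), a n + R N := by
    intro N
    induction N with
    | zero =>
      have h1 : Real.Gamma (1/2) = √Real.pi := Real.Gamma_one_half_eq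
      have h2 : √Real.pi ≠ 0 := by positivity
      have h3 : a 0 = 1 := by
        simp only [ha, Nat.cast_zero, zero_add, h1, pow_zero, mul_one]
        exact div_self h2
      have h4 : R 0 = 2 * y * Real.exp x * ∫ t in (0:ℝ)..y, Real.exp (-t ^ 2) := by
        simp only [hR, hJ, Nat.cast_zero, zero_add, h1, mul_zero, pow_zero, one_mul, div_self h2]
      rw [zero_add, Finset.sum_range_one, h3, h4]
    | succ N ih =>
      rw [ih, Finset.sum_range_succ _ (N + 1), add_assoc]
      congr 1
      have hrec : (2 * N + 1 : ℝ) * J N = y ^ (2 * N + 1) * Real.exp (-y ^ 2) + 2 * J (N + 1) :=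
        J_rec y N
      have hg := (hG N).ne'
      have hn : (2 * N + 1 : ℝ) ≠ 0 := by positivity
      have hJN : J N = (y ^ (2 * N + 1) * Real.exp (-y ^ 2) + 2 * J (N + 1)) / (2 * N + 1) := by
        rw [eq_div_iff hn, ← hrec]; ring
      have hE : Real.exp x * Real.exp (-y ^ 2) = 1 := by
        rw [hyx, ← Real.exp_add]; simp
      have hp : y * y ^ (2 * N + 1) = x ^ (N + 1) := by
        rw [← hyx]; ring
      have hhalf : (N + 1/2 : ℝ) = (2 * N + 1) / 2 := by ring
      have e1 : 2 * y * Real.exp x * J N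
          = (2 * x ^ (N + 1) + 2 * (2 * y * Real.exp x * J (N + 1))) / (2 * N + 1) := by
        rw [hJN, ← hp]
        rw [mul_div_assoc']
        congr 1
        linear_combination (2 * y * y ^ (2 * N + 1)) * hE
      simp only [hR, ha]
      rw [hGs, e1]
      generalize Real.Gamma (N + 1/2) = g at hg
      rw [hhalf]
      field_simp
  have hsum : Summable a := by
    apply summable_of_sum_range_le (c := S) ha0
    intro n
    have := key n
    rw [Finset.sum_range_succ] at this
    linarith [ha0 n, hR0 n]
  have hRt : Filter.Tendsto R Filter.atTop (nhds 0) := by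
    apply squeeze_zero hR0 hRle
    simpa using hsum.tendsto_atTop_zero.const_mul (2 * x * Real.exp x)
  rw [hasSum_iff_tendsto_nat_of_nonneg ha0, ← Filter.tendsto_add_atTop_iff_nat 1]
  have h := hRt.const_sub S
  rw [sub_zero] at h
  refine h.congr (fun N => ?_)
  linarith [key N]
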